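/- Let d ≥ 3, n > d, let k ≥ 0 be an integer, and let c_1, …, c_{n−d} be real numbers with pairwise distinct fractional parts such that k·c_j + 1/2 is not an integer for any j. Consider the n subtori of T^d = ℝ^d/ℤ^d that are the images under φ of the hyperplanes x_i = 0 for 2 ≤ i ≤ d, the hyperplane x_2 = k·x_1 + 1/2, and the hyperplanes x_1 = c_j for 1 ≤ j ≤ n − d. Then the complement in T^d of the union of these n subtori has exactly 2n − 2d + k connected components. -/

import Mathlib

open scoped BigOperators

noncomputable section

/-- The flat `d`-dimensional torus `ℝ^d / ℤ^d`, modeled as a product of circles `ℝ/ℤ`. -/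
abbrev FlatTorus (d : ℕ) := Fin d → AddCircle (1 : ℝ)

/-- The quotient map `φ : ℝ^d → T^d`. -/
def torusQuot (d : ℕ) : (Fin d → ℝ) → FlatTorus d := fun x i => (x i : AddCircle (1 : ℝ))

/-- A closed codimension-one subtorus of `T^d`: the image under `φ` of an affine hyperplane
`{x | ∑ i, a i * x i = c}` with `a` a primitive integer vector. -/
def IsCodimOneSubtorus {d : ℕ} (A : Set (FlatTorus d)) : Prop :=
  ∃ (a : Fin d → ℤ) (c : ℝ),
    Finset.univ.gcd a = 1 ∧
    A = torusQuot d '' {x | ∑ i, (a i : ℝ) * x i = c}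

open Filter Topology

/-- A space covered by finitely many disjoint open connected sets has one component for each. -/
theorem card_connectedComponents_of_iUnion_eq {α ι : Type*} [TopologicalSpace α] [Finite ι]
    {X : Set α} {S : ι → Set α} (hopen : ∀ i, IsOpen (S i)) (hconn : ∀ i, IsConnected (S i))
    (hdisj : Pairwise (Function.onFun Disjoint S)) (hunion : ⋃ i, S i = X) :
    Nat.card (ConnectedComponents X) = Nat.card ι := by
  have hsub (i : ι) : S i ⊆ X := hunion ▸ Set.subset_iUnion S i
  let U (i : ι) : Set X := Subtype.val ⁻¹' S i
  have hUopen (i : ι) : IsOpen (U i) := (hopen i).preimage continuous_subtype_val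
  have hUdisj : Pairwise (Function.onFun Disjoint U) := fun i j hij =>
    (hdisj hij).preimage Subtype.val
  have hUunion : ⋃ i, U i = Set.univ := by
    rw [← Set.preimage_iUnion, hunion, Subtype.coe_preimage_self]
  have hUclopen (i : ι) : IsClopen (U i) := by
    refine ⟨⟨?_⟩, hUopen i⟩
    have : (U i)ᶜ = ⋃ j : {j // j ≠ i}, U j := by
      ext x
      obtain ⟨j, hj⟩ := Set.iUnion_eq_univ_iff.mp hUunion x
      simp only [Set.mem_compl_iff, Set.mem_iUnion, Subtype.exists, exists_prop]
      constructor
      · intro hx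
        exact ⟨j, fun h => hx (h ▸ hj), hj⟩
      · rintro ⟨l, hl, hxl⟩ hxi
        exact Set.disjoint_left.mp (hUdisj hl) hxl hxi
    rw [this]
    exact isOpen_iUnion fun j => hUopen j
  have hUconn (i : ι) : IsConnected (U i) := by
    have himage : Subtype.val '' U i = S i := by
      rw [Subtype.image_preimage_coe, Set.inter_eq_right.mpr (hsub i)]
    refine ⟨?_, ?_⟩
    · obtain ⟨x, hx⟩ := (hconn i).nonempty
      exact ⟨⟨x, hsub i hx⟩, hx⟩
    · rw [← IsInducing.subtypeVal.isPreconnected_image, himage]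
      exact (hconn i).isPreconnected
  exact Nat.card_congr
    (ConnectedComponents.equivOfIsClopenOfIsConnected hUclopen hUdisj hUunion hUconn)

theorem isOpenMap_torusQuot (d : ℕ) : IsOpenMap (torusQuot d) :=
  (IsOpenQuotientMap.piMap fun _ : Fin d => QuotientAddGroup.isOpenQuotientMap_mk).isOpenMap

theorem continuous_torusQuot (d : ℕ) : Continuous (torusQuot d) :=
  continuous_pi fun i => (AddCircle.continuous_mk' 1).comp (continuous_apply i)

theorem surjective_torusQuot (d : ℕ) : Function.Surjective (torusQuot d) := by
  intro y
  choose x hx using fun i => QuotientAddGroup.mk_surjective (y i)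
  exact ⟨x, funext hx⟩

theorem torusQuot_eq_iff {d : ℕ} {x y : Fin d → ℝ} :
    torusQuot d x = torusQuot d y ↔ ∀ i, ∃ m : ℤ, x i - y i = m := by
  simp only [torusQuot, funext_iff]
  refine forall_congr' fun i => ?_
  rw [← sub_eq_zero, ← AddCircle.coe_sub, AddCircle.coe_eq_zero_iff]
  simp [eq_comm]

/-- Membership in the image of a graph hyperplane `x i = f x`, when `f` does not depend on `x i`
and changes by integers under integer translations. -/
theorem torusQuot_mem_image_graph_iff {d : ℕ} (i : Fin d) (f : (Fin d → ℝ) → ℝ)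
    (hf : ∀ x a, f (Function.update x i a) = f x)
    (hfm : ∀ x y : Fin d → ℝ, (∀ j, ∃ m : ℤ, x j - y j = m) → ∃ m : ℤ, f x - f y = m) (x : Fin d → ℝ) :
    torusQuot d x ∈ torusQuot d '' {y | y i = f y} ↔ ∃ m : ℤ, x i - f x = m := by
  constructor
  · rintro ⟨y, hy, hyx⟩
    have h := torusQuot_eq_iff.mp hyx.symm
    obtain ⟨m, hm⟩ := h i
    obtain ⟨l, hl⟩ := hfm x y h
    refine ⟨m - l, ?_⟩
    have hy : y i = f y := hy
    push_cast
    linarith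
  · rintro ⟨m, hm⟩
    refine ⟨Function.update x i (f x), ?_, ?_⟩
    · simp [hf]
    · refine torusQuot_eq_iff.mpr fun j => ?_
      by_cases hj : j = i
      · subst hj
        exact ⟨-m, by simp [← hm]⟩
      · exact ⟨0, by simp [hj]⟩

variable {ι : Type*}

section Steps

variable [Fintype ι]

/-- The step function counting the crossings of the arrangement with `x₂ = 0⁺`, a line
`x₁ = c j` being counted twice. -/
def crossingCount (k : ℕ) (c : ι → ℝ) (t : ℝ) : ℤ :=
  ⌊(k : ℝ) * t + 1 / 2⌋ + 2 * ∑ j, ⌊t - c j⌋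

theorem monotone_crossingCount (k : ℕ) (c : ι → ℝ) : Monotone (crossingCount k c) := by
  intro s t hst
  unfold crossingCount
  gcongr

theorem crossingCount_add_intCast (k : ℕ) (c : ι → ℝ) (t : ℝ) (m : ℤ) :
    crossingCount k c (t + m) = crossingCount k c t + m * (k + 2 * Fintype.card ι) := by
  have h1 : (k : ℝ) * (t + m) + 1 / 2 = (k : ℝ) * t + 1 / 2 + ((k * m : ℤ) : ℝ) := by
    push_cast; ring
  have h2 (j : ι) : t + m - c j = t - c j + (m : ℝ) := by ring
  simp only [crossingCount, h1, h2, Int.floor_add_intCast, Finset.sum_add_distrib,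
    Finset.sum_const, Finset.card_univ, nsmul_eq_mul]
  ring

theorem eventually_floor_le {f : ℝ → ℝ} {t : ℝ} (hf : ContinuousAt f t) :
    ∀ᶠ s in 𝓝 t, ⌊f s⌋ ≤ ⌊f t⌋ := by
  filter_upwards [hf.eventually_lt continuousAt_const (Int.lt_floor_add_one (f t))] with s hs
  exact Int.lt_add_one_iff.mp (Int.floor_lt.mpr (by exact_mod_cast hs))

theorem eventually_ceil_sub_one_le_floor {f : ℝ → ℝ} {t : ℝ} (hf : ContinuousAt f t) :
    ∀ᶠ s in 𝓝 t, ⌈f t⌉ - 1 ≤ ⌊f s⌋ := by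
  have h : ((⌈f t⌉ - 1 : ℤ) : ℝ) < f t := by
    have := Int.ceil_lt_add_one (f t)
    push_cast
    linarith
  filter_upwards [continuousAt_const.eventually_lt hf h] with s hs
  exact Int.le_floor.mpr hs.le

theorem eventually_floors_eq (k : ℕ) (c : ι → ℝ) (t : ℝ) :
    ∀ᶠ s in 𝓝[>] t, ⌊(k : ℝ) * s + 1 / 2⌋ = ⌊(k : ℝ) * t + 1 / 2⌋ ∧
      ∀ j, ⌊s - c j⌋ = ⌊t - c j⌋ := by
  have h1 := nhdsWithin_le_nhds (s := Set.Ioi t) <|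
    eventually_floor_le (f := fun s => (k : ℝ) * s + 1 / 2) (t := t) (by fun_prop)
  have h2 : ∀ᶠ s in 𝓝[>] t, ∀ j, ⌊s - c j⌋ ≤ ⌊t - c j⌋ := eventually_all.mpr fun j =>
    nhdsWithin_le_nhds <| eventually_floor_le (f := fun s => s - c j) (by fun_prop)
  filter_upwards [h1, h2, self_mem_nhdsWithin] with s hs1 hs2 hst
  have hst : t < s := hst
  exact ⟨le_antisymm hs1 (by gcongr), fun j => le_antisymm (hs2 j) (by gcongr)⟩

theorem eventually_crossingCount_eq (k : ℕ) (c : ι → ℝ) (t : ℝ) :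
    ∀ᶠ s in 𝓝[>] t, crossingCount k c s = crossingCount k c t := by
  filter_upwards [eventually_floors_eq k c t] with s hs
  simp only [crossingCount, hs.1, hs.2]

theorem floor_sub_ceil_le_zero {a : ℝ} (h : ¬∃ m : ℤ, a = m) : ⌊a⌋ - (⌈a⌉ - 1) ≤ 0 := by
  have : ⌊a⌋ < ⌈a⌉ := by
    refine Int.lt_ceil.mpr (lt_of_le_of_ne (Int.floor_le a) fun e => h ⟨_, e.symm⟩)
  omega

/-- The jumps of `crossingCount` are at most `2` when no two walls are crossed at once. -/
theorem eventually_crossingCount_ge (k : ℕ) (c : ι → ℝ)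
    (hc : ∀ i j, Int.fract (c i) = Int.fract (c j) → i = j)
    (hkc : ∀ j, ¬∃ m : ℤ, (k : ℝ) * c j + 1 / 2 = (m : ℝ)) (t : ℝ) :
    ∀ᶠ s in 𝓝 t, crossingCount k c t - 2 ≤ crossingCount k c s := by
  classical
  have h1 := eventually_ceil_sub_one_le_floor (f := fun s => (k : ℝ) * s + 1 / 2) (t := t)
    (by fun_prop)
  have h2 : ∀ᶠ s in 𝓝 t, ∀ j, ⌈t - c j⌉ - 1 ≤ ⌊s - c j⌋ := eventually_all.mpr fun j =>
    eventually_ceil_sub_one_le_floor (f := fun s => s - c j) (by fun_prop)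
  filter_upwards [h1, h2] with s hs1 hs2
  have hle (a : ℝ) : ⌊a⌋ - (⌈a⌉ - 1) ≤ 1 := by
    have := Int.floor_le_ceil a
    omega
  have hsum : ∑ j, (⌈t - c j⌉ - 1) ≤ ∑ j, ⌊s - c j⌋ := Finset.sum_le_sum fun j _ => hs2 j
  suffices ⌊(k : ℝ) * t + 1 / 2⌋ - (⌈(k : ℝ) * t + 1 / 2⌉ - 1)
      + 2 * ∑ j, (⌊t - c j⌋ - (⌈t - c j⌉ - 1)) ≤ 2 by
    rw [Finset.sum_sub_distrib] at this
    unfold crossingCount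
    linarith
  by_cases h : ∃ j, ∃ m : ℤ, t - c j = m
  · obtain ⟨j, m, hm⟩ := h
    have hk : ⌊(k : ℝ) * t + 1 / 2⌋ - (⌈(k : ℝ) * t + 1 / 2⌉ - 1) ≤ 0 := by
      refine floor_sub_ceil_le_zero ?_
      rintro ⟨l, hl⟩
      refine hkc j ⟨l - k * m, ?_⟩
      push_cast
      rw [← hl, ← hm]
      ring
    have hj : ∑ i, (⌊t - c i⌋ - (⌈t - c i⌉ - 1)) ≤ ∑ i, if i = j then 1 else 0 := by
      refine Finset.sum_le_sum fun i _ => ?_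
      split_ifs with hij
      · exact hle _
      · refine floor_sub_ceil_le_zero ?_
        rintro ⟨l, hl⟩
        refine hij (hc i j (Int.fract_eq_fract.mpr ⟨m - l, ?_⟩))
        push_cast
        linarith
    rw [Finset.sum_ite_eq' Finset.univ j, if_pos (Finset.mem_univ j)] at hj
    linarith
  · have hj : ∑ i, (⌊t - c i⌋ - (⌈t - c i⌉ - 1)) ≤ 0 :=
      Finset.sum_nonpos fun i _ => floor_sub_ceil_le_zero fun hi => h ⟨i, hi⟩
    linarith [hle ((k : ℝ) * t + 1 / 2)]

/-- `crossingCount` skips no two consecutive integers. -/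
theorem exists_crossingCount_eq [Nonempty ι] (k : ℕ) (c : ι → ℝ)
    (hc : ∀ i j, Int.fract (c i) = Int.fract (c j) → i = j)
    (hkc : ∀ j, ¬∃ m : ℤ, (k : ℝ) * c j + 1 / 2 = (m : ℝ)) (v : ℤ) :
    ∃ t, crossingCount k c t = v ∨ crossingCount k c t = v + 1 := by
  have hN : (1 : ℤ) ≤ k + 2 * Fintype.card ι := by
    have := Fintype.card_pos (α := ι)
    omega
  set S : Set ℝ := {t | v ≤ crossingCount k c t}
  set g := crossingCount k c 0
  have hshift (m : ℤ) := crossingCount_add_intCast k c 0 m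
  simp only [zero_add] at hshift
  have hne : S.Nonempty := by
    refine ⟨((|v| + |g| : ℤ) : ℝ), ?_⟩
    change v ≤ crossingCount k c _
    rw [hshift]
    have := le_abs_self v
    have := neg_abs_le g
    have := abs_nonneg v
    have := abs_nonneg g
    nlinarith
  have hbdd : BddBelow S := by
    refine ⟨((-(|v| + |g| + 1) : ℤ) : ℝ), fun t ht => ?_⟩
    by_contra! hlt
    have h := monotone_crossingCount k c hlt.le
    rw [hshift] at h
    have ht : v ≤ crossingCount k c t := ht
    have := neg_abs_le v
    have := le_abs_self g
    have := abs_nonneg v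
    have := abs_nonneg g
    change _ ≤ g + _ at h
    nlinarith
  refine ⟨sInf S, ?_⟩
  have hge : v ≤ crossingCount k c (sInf S) := by
    obtain ⟨u, hu, huS⟩ := mem_nhdsGT_iff_exists_Ioo_subset.mp
      (eventually_crossingCount_eq k c (sInf S))
    obtain ⟨t, htS, htu⟩ := exists_lt_of_csInf_lt hne hu
    have ht : v ≤ crossingCount k c t := htS
    rcases (csInf_le hbdd htS).eq_or_lt with h | h
    · rwa [h]
    · have : crossingCount k c t = crossingCount k c (sInf S) := huS ⟨h, htu⟩
      rwa [← this]
  have hlt : crossingCount k c (sInf S) ≤ v + 1 := by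
    obtain ⟨t, ht, htS⟩ := (((eventually_crossingCount_ge k c hc hkc (sInf S)).filter_mono
      nhdsWithin_le_nhds).and (self_mem_nhdsWithin (s := Set.Iio (sInf S)))).exists
    have : crossingCount k c t < v :=
      not_le.mp (notMem_of_lt_csInf (s := S) htS hbdd)
    omega
  omega

end Steps

variable {d : ℕ}

/-- The preimage in `ℝ^d` of the complement of the arrangement, cut down to a fundamental domain
in all the coordinates but the `p`-th one. -/
def liftedComplement (k : ℕ) (c : ι → ℝ) (p q : Fin d) : Set (Fin d → ℝ) :=
  {x | (∀ i, i ≠ p → 0 < x i ∧ x i < 1) ∧ (¬∃ m : ℤ, (k : ℝ) * x p + 1 / 2 - x q = m) ∧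
    ∀ j, ¬∃ m : ℤ, x p - c j = m}

/-- The product-like cell of `liftedComplement` with prescribed integer parts. -/
def liftedCell (k : ℕ) (c : ι → ℝ) (p q : Fin d) (a : ℤ) (b : ι → ℤ) : Set (Fin d → ℝ) :=
  {x | (∀ i, i ≠ p → 0 < x i ∧ x i < 1) ∧
    ((a : ℝ) < (k : ℝ) * x p + 1 / 2 - x q ∧ (k : ℝ) * x p + 1 / 2 - x q < a + 1) ∧
    ∀ j, (b j : ℝ) < x p - c j ∧ x p - c j < b j + 1}

theorem floor_eq_and_notInt_iff {a : ℝ} {m : ℤ} :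
    ((m : ℝ) < a ∧ a < m + 1) ↔ (¬∃ l : ℤ, a = l) ∧ ⌊a⌋ = m := by
  constructor
  · rintro ⟨h1, h2⟩
    refine ⟨?_, Int.floor_eq_iff.mpr ⟨h1.le, h2⟩⟩
    rintro ⟨l, rfl⟩
    norm_cast at h1 h2
    omega
  · rintro ⟨h, rfl⟩
    exact ⟨lt_of_le_of_ne (Int.floor_le a) fun e => h ⟨_, e.symm⟩, Int.lt_floor_add_one a⟩

theorem mem_liftedCell_iff {k : ℕ} {c : ι → ℝ} {p q : Fin d} {a : ℤ} {b : ι → ℤ}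
    {x : Fin d → ℝ} :
    x ∈ liftedCell k c p q a b ↔ x ∈ liftedComplement k c p q ∧
      ⌊(k : ℝ) * x p + 1 / 2 - x q⌋ = a ∧ ∀ j, ⌊x p - c j⌋ = b j := by
  simp only [liftedCell, liftedComplement, Set.mem_ofPred_eq, floor_eq_and_notInt_iff, forall_and]
  tauto

theorem isOpen_liftedCell [Finite ι] (k : ℕ) (c : ι → ℝ) (p q : Fin d) (a : ℤ) (b : ι → ℤ) :
    IsOpen (liftedCell k c p q a b) := by
  refine IsOpen.and ?_ (IsOpen.and ?_ ?_)
  · simp only [Set.ofPred_forall]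
    exact isOpen_iInter_of_finite fun i => isOpen_iInter_of_finite fun _ =>
      (isOpen_lt (by fun_prop) (by fun_prop)).and (isOpen_lt (by fun_prop) (by fun_prop))
  · exact (isOpen_lt (by fun_prop) (by fun_prop)).and (isOpen_lt (by fun_prop) (by fun_prop))
  · simp only [Set.ofPred_forall]
    exact isOpen_iInter_of_finite fun j =>
      (isOpen_lt (by fun_prop) (by fun_prop)).and (isOpen_lt (by fun_prop) (by fun_prop))

theorem convex_liftedCell (k : ℕ) (c : ι → ℝ) (p q : Fin d) (a : ℤ) (b : ι → ℤ) :
    Convex ℝ (liftedCell k c p q a b) := by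
  have key (l m u v r s : ℝ) (hr : 0 ≤ r) (hs : 0 ≤ s) (hrs : r + s = 1) (hu : l < u ∧ u < m)
      (hv : l < v ∧ v < m) : l < r * u + s * v ∧ r * u + s * v < m := by
    simpa using (convex_Ioo l m) (Set.mem_Ioo.mpr hu) (Set.mem_Ioo.mpr hv) hr hs hrs
  rintro x ⟨hx1, hx2, hx3⟩ y ⟨hy1, hy2, hy3⟩ r s hr hs hrs
  refine ⟨fun i hi => ?_, ?_, fun j => ?_⟩
  · exact key _ _ _ _ r s hr hs hrs (hx1 i hi) (hy1 i hi)
  · convert key _ _ _ _ r s hr hs hrs hx2 hy2 using 2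
    all_goals
      simp only [Pi.add_apply, Pi.smul_apply, smul_eq_mul]
      linear_combination (1 / 2 : ℝ) * (-hrs)
  · convert key _ _ _ _ r s hr hs hrs (hx3 j) (hy3 j) using 2
    all_goals
      simp only [Pi.add_apply, Pi.smul_apply, smul_eq_mul]
      linear_combination c j * hrs

section Chambers

variable [Fintype ι]

/-- The integer label of the chamber of `liftedComplement` containing a point. -/
def chamberLabel (k : ℕ) (c : ι → ℝ) (p q : Fin d) (x : Fin d → ℝ) : ℤ :=
  ⌊(k : ℝ) * x p + 1 / 2 - x q⌋ + 2 * ∑ j, ⌊x p - c j⌋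

/-- The chamber of `liftedComplement` with a given label. -/
def liftedChamber (k : ℕ) (c : ι → ℝ) (p q : Fin d) (v : ℤ) : Set (Fin d → ℝ) :=
  {x | x ∈ liftedComplement k c p q ∧ chamberLabel k c p q x = v}

theorem liftedCell_subset_liftedChamber (k : ℕ) (c : ι → ℝ) (p q : Fin d) (a : ℤ) (b : ι → ℤ) :
    liftedCell k c p q a b ⊆ liftedChamber k c p q (a + 2 * ∑ j, b j) := by
  intro x hx
  obtain ⟨h, ha, hb⟩ := mem_liftedCell_iff.mp hx
  exact ⟨h, by simp only [chamberLabel, ha, hb]⟩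

theorem isOpen_liftedChamber (k : ℕ) (c : ι → ℝ) (p q : Fin d) (v : ℤ) :
    IsOpen (liftedChamber k c p q v) := by
  refine isOpen_iff_mem_nhds.mpr ?_
  rintro x ⟨hx, rfl⟩
  exact mem_of_superset ((isOpen_liftedCell k c p q _ _).mem_nhds
    (mem_liftedCell_iff.mpr ⟨hx, rfl, fun _ => rfl⟩)) (liftedCell_subset_liftedChamber k c p q _ _)

theorem floors_eq_of_chamberLabel_eq {k : ℕ} {c : ι → ℝ} {p q : Fin d} (hpq : q ≠ p)
    {x y : Fin d → ℝ} (hx : x ∈ liftedComplement k c p q) (hy : y ∈ liftedComplement k c p q)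
    (h : chamberLabel k c p q x = chamberLabel k c p q y) :
    ⌊(k : ℝ) * x p + 1 / 2 - x q⌋ = ⌊(k : ℝ) * y p + 1 / 2 - y q⌋ ∧
      ∀ j, ⌊x p - c j⌋ = ⌊y p - c j⌋ := by
  wlog hxy : x p ≤ y p generalizing x y
  · obtain ⟨h1, h2⟩ := this hy hx h.symm (le_of_not_ge hxy)
    exact ⟨h1.symm, fun j => (h2 j).symm⟩
  have hle (j : ι) : ⌊x p - c j⌋ ≤ ⌊y p - c j⌋ := by gcongr
  suffices hfl : ∀ j, ⌊x p - c j⌋ = ⌊y p - c j⌋ by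
    refine ⟨?_, hfl⟩
    simpa only [chamberLabel, hfl, add_left_inj] using h
  by_contra! hne
  obtain ⟨j, hj⟩ := hne
  have hsum : ∑ j, ⌊x p - c j⌋ < ∑ j, ⌊y p - c j⌋ :=
    Finset.sum_lt_sum (fun i _ => hle i) ⟨j, Finset.mem_univ j, lt_of_le_of_ne (hle j) hj⟩
  have hk : (k : ℝ) * x p ≤ k * y p := by gcongr
  have hxq := hx.1 q hpq
  have hyq := hy.1 q hpq
  have hfloor : ⌊(k : ℝ) * x p + 1 / 2 - x q⌋ - 1 ≤ ⌊(k : ℝ) * y p + 1 / 2 - y q⌋ := by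
    refine Int.le_floor.mpr ?_
    have := Int.floor_le ((k : ℝ) * x p + 1 / 2 - x q)
    push_cast
    linarith
  unfold chamberLabel at h
  omega

theorem convex_liftedChamber (k : ℕ) (c : ι → ℝ) {p q : Fin d} (hpq : q ≠ p) (v : ℤ) :
    Convex ℝ (liftedChamber k c p q v) := by
  rintro x ⟨hx, rfl⟩ y ⟨hy, hxy⟩ r s hr hs hrs
  obtain ⟨h1, h2⟩ := floors_eq_of_chamberLabel_eq hpq hy hx hxy
  exact liftedCell_subset_liftedChamber k c p q _ _ <| convex_liftedCell k c p q _ _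
    (mem_liftedCell_iff.mpr ⟨hx, rfl, fun _ => rfl⟩) (mem_liftedCell_iff.mpr ⟨hy, h1, h2⟩) hr hs hrs

theorem nonempty_liftedChamber [Nonempty ι] (k : ℕ) (c : ι → ℝ)
    (hc : ∀ i j, Int.fract (c i) = Int.fract (c j) → i = j)
    (hkc : ∀ j, ¬∃ m : ℤ, (k : ℝ) * c j + 1 / 2 = (m : ℝ)) {p q : Fin d} (hpq : q ≠ p) (v : ℤ) :
    (liftedChamber k c p q v).Nonempty := by
  obtain ⟨T, hT⟩ := exists_crossingCount_eq k c hc hkc v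
  obtain ⟨t, ⟨ht1, ht2⟩, htT⟩ :=
    ((eventually_floors_eq k c T).and self_mem_nhdsWithin).exists
  have htT : T < t := htT
  have hgen (j : ι) : ((⌊T - c j⌋ : ℤ) : ℝ) < t - c j ∧ t - c j < (⌊T - c j⌋ : ℤ) + 1 := by
    refine ⟨?_, ?_⟩
    · linarith [Int.floor_le (T - c j)]
    · rw [← ht2 j]
      exact Int.lt_floor_add_one _
  set a := ⌊(k : ℝ) * T + 1 / 2⌋ with ha
  have hlo : (a : ℝ) < k * t + 1 / 2 := by
    rcases Nat.eq_zero_or_pos k with rfl | hk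
    · have : a = 0 := by rw [ha]; norm_num
      rw [this]; norm_num
    · have hk : (0 : ℝ) < k := by exact_mod_cast hk
      have := Int.floor_le ((k : ℝ) * T + 1 / 2)
      have := mul_lt_mul_of_pos_left htT hk
      linarith
  have hhi : (k : ℝ) * t + 1 / 2 < a + 1 := by
    rw [← ht1]
    exact Int.lt_floor_add_one _
  have hmem (s : ℝ) (b : ℤ) (hs0 : 0 < s) (hs1 : s < 1) (hb : (b : ℝ) < k * t + 1 / 2 - s)
      (hb' : (k : ℝ) * t + 1 / 2 - s < b + 1) (hv : b + 2 * ∑ j, ⌊T - c j⌋ = v) :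
      (liftedChamber k c p q v).Nonempty := by
    refine ⟨Function.update (fun _ => s) p t, ?_⟩
    rw [← hv]
    refine liftedCell_subset_liftedChamber k c p q b _ ⟨fun i hi => ?_, ?_, fun j => ?_⟩
    · simpa [hi] using ⟨hs0, hs1⟩
    · simpa only [Function.update_self, Function.update_of_ne hpq] using And.intro hb hb'
    · simpa using hgen j
  unfold crossingCount at hT
  rcases hT with hT | hT
  · exact hmem ((k * t + 1 / 2 - a) / 2) a (by linarith) (by linarith) (by linarith) (by linarith)
      hT
  · refine hmem ((k * t + 1 / 2 - a + 1) / 2) (a - 1) (by linarith) (by linarith) ?_ ?_ (by omega)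
    · push_cast; linarith
    · push_cast; linarith

/-- Translating the `p`-th coordinate by an integer shifts the chamber label. -/
theorem mem_liftedChamber_of_translate {k : ℕ} {c : ι → ℝ} {p q : Fin d} {v : ℤ}
    {x y : Fin d → ℝ} (m : ℤ) (hpq : q ≠ p) (hx : x ∈ liftedChamber k c p q v)
    (hp : y p = x p + m) (hy : ∀ i, i ≠ p → y i = x i) :
    y ∈ liftedChamber k c p q (v + m * (k + 2 * Fintype.card ι)) := by
  obtain ⟨hx, rfl⟩ := hx
  have hxc := mem_liftedCell_iff.mpr (⟨hx, rfl, fun _ => rfl⟩ : _ ∧ _ ∧ ∀ j, _ = ⌊x p - c j⌋)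
  have : y ∈ liftedCell k c p q (⌊(k : ℝ) * x p + 1 / 2 - x q⌋ + k * m)
      (fun j => ⌊x p - c j⌋ + m) := by
    refine ⟨fun i hi => hy i hi ▸ hxc.1 i hi, ?_, fun j => ?_⟩
    · have := hxc.2.1
      rw [hp, hy q hpq]
      push_cast
      constructor <;> linarith
    · have := hxc.2.2 j
      rw [hp]
      push_cast
      constructor <;> linarith
  convert liftedCell_subset_liftedChamber k c p q _ _ this using 2
  simp only [chamberLabel, Finset.sum_add_distrib, Finset.sum_const, Finset.card_univ,
    nsmul_eq_mul]
  ring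

theorem eq_of_sub_eq_intCast {a b : ℝ} (ha : 0 < a ∧ a < 1) (hb : 0 < b ∧ b < 1) {m : ℤ}
    (h : a - b = m) : a = b := by
  have h1 : (m : ℝ) < 1 := by linarith
  have h2 : (-1 : ℝ) < m := by linarith
  norm_cast at h1
  have h2 : -1 < m := by exact_mod_cast h2
  obtain rfl : m = 0 := by omega
  simpa [sub_eq_zero] using h

theorem torusQuot_image_liftedChamber_add (k : ℕ) (c : ι → ℝ) {p q : Fin d} (hpq : q ≠ p)
    (v m : ℤ) : torusQuot d '' liftedChamber k c p q v ⊆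
      torusQuot d '' liftedChamber k c p q (v + m * (k + 2 * Fintype.card ι)) := by
  rintro _ ⟨x, hx, rfl⟩
  refine ⟨Function.update x p (x p + m), mem_liftedChamber_of_translate m hpq hx (by simp)
    fun i hi => by simp [hi], torusQuot_eq_iff.mpr fun i => ?_⟩
  by_cases hi : i = p
  · subst hi
    exact ⟨m, by simp⟩
  · exact ⟨0, by simp [hi]⟩

theorem dvd_of_not_disjoint_image_liftedChamber {k : ℕ} {c : ι → ℝ} {p q : Fin d} (hpq : q ≠ p)
    {v w : ℤ} (h : ¬Disjoint (torusQuot d '' liftedChamber k c p q v)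
      (torusQuot d '' liftedChamber k c p q w)) :
    ((k + 2 * Fintype.card ι : ℕ) : ℤ) ∣ w - v := by
  obtain ⟨_, ⟨x, hx, rfl⟩, ⟨y, hy, hyx⟩⟩ := Set.not_disjoint_iff.mp h
  have hm := torusQuot_eq_iff.mp hyx
  obtain ⟨m, hmp⟩ := hm p
  have hy' := mem_liftedChamber_of_translate (y := y) m hpq hx (by linarith) fun i hi => by
    obtain ⟨l, hl⟩ := hm i
    exact eq_of_sub_eq_intCast (hy.1.1 i hi) (hx.1.1 i hi) hl
  refine ⟨m, ?_⟩
  have := hy.2.symm.trans hy'.2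
  push_cast
  linarith

theorem iUnion_image_liftedChamber (k : ℕ) (c : ι → ℝ) {p q : Fin d} (hpq : q ≠ p)
    (hN : 0 < k + 2 * Fintype.card ι) :
    ⋃ v : Fin (k + 2 * Fintype.card ι), torusQuot d '' liftedChamber k c p q (v : ℕ) =
      torusQuot d '' liftedComplement k c p q := by
  refine Set.Subset.antisymm (Set.iUnion_subset fun v => Set.image_mono fun x hx => hx.1) ?_
  rintro _ ⟨x, hx, rfl⟩
  set N := k + 2 * Fintype.card ι with hNdef
  set l := chamberLabel k c p q x
  have hpos : (0 : ℤ) < N := by exact_mod_cast hN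
  have h := torusQuot_image_liftedChamber_add k c hpq l (-(l / N))
    ⟨x, ⟨hx, rfl⟩, rfl⟩
  have h0 := Int.emod_nonneg l hpos.ne'
  have h1 := Int.emod_lt_of_pos l hpos
  refine Set.mem_iUnion.mpr ⟨⟨(l % N).toNat, by omega⟩, ?_⟩
  convert h using 3
  have := Int.emod_add_mul_ediv l N
  rw [Int.toNat_of_nonneg h0]
  have hN' : (N : ℤ) = k + 2 * Fintype.card ι := by rw [hNdef]; push_cast; rfl
  rw [← hN']
  linarith

theorem card_connectedComponents_image_liftedComplement [Nonempty ι] (k : ℕ) (c : ι → ℝ)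
    (hc : ∀ i j, Int.fract (c i) = Int.fract (c j) → i = j)
    (hkc : ∀ j, ¬∃ m : ℤ, (k : ℝ) * c j + 1 / 2 = (m : ℝ)) {p q : Fin d} (hpq : q ≠ p) :
    Nat.card (ConnectedComponents (torusQuot d '' liftedComplement k c p q)) =
      k + 2 * Fintype.card ι := by
  have hN : 0 < k + 2 * Fintype.card ι := by
    have := Fintype.card_pos (α := ι)
    omega
  rw [card_connectedComponents_of_iUnion_eq (ι := Fin (k + 2 * Fintype.card ι))
    (S := fun v => torusQuot d '' liftedChamber k c p q (v : ℕ)) ?_ ?_ ?_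
    (iUnion_image_liftedChamber k c hpq hN), Nat.card_fin]
  · exact fun v => isOpenMap_torusQuot d _ (isOpen_liftedChamber k c p q _)
  · exact fun v => ⟨(nonempty_liftedChamber k c hc hkc hpq _).image _,
      (convex_liftedChamber k c hpq _).isPreconnected.image _
        (continuous_torusQuot d).continuousOn⟩
  · intro v w hvw
    by_contra h
    have hdvd := dvd_of_not_disjoint_image_liftedChamber hpq h
    have hv := v.isLt
    have hw := w.isLt
    refine hvw (Fin.ext ?_)
    have := Int.eq_zero_of_abs_lt_dvd hdvd (by rw [abs_lt]; omega)
    omega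

end Chambers

theorem torusQuot_image_liftedComplement (k : ℕ) (c : ι → ℝ) {p q : Fin d} (hpq : q ≠ p) :
    torusQuot d '' liftedComplement k c p q =
      {y | (∀ i, i ≠ p → y ∉ torusQuot d '' {x | x i = 0}) ∧
        y ∉ torusQuot d '' {x | x q = (k : ℝ) * x p + 1 / 2} ∧
        ∀ j, y ∉ torusQuot d '' {x | x p = c j}} := by
  have hcoord (i : Fin d) (a : ℝ) (x : Fin d → ℝ) := torusQuot_mem_image_graph_iff i (fun _ => a)
    (fun _ _ => rfl) (fun _ _ _ => ⟨0, by simp⟩) x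
  have hskew (x : Fin d → ℝ) := torusQuot_mem_image_graph_iff q
    (fun x => (k : ℝ) * x p + 1 / 2) (fun x a => by simp [hpq.symm])
    (fun x y h => by
      obtain ⟨m, hm⟩ := h p
      refine ⟨k * m, ?_⟩
      push_cast
      rw [← hm]
      ring) x
  have hneg (x : Fin d → ℝ) : (∃ m : ℤ, (k : ℝ) * x p + 1 / 2 - x q = m) ↔
      ∃ m : ℤ, x q - ((k : ℝ) * x p + 1 / 2) = m := by
    constructor <;>
    · rintro ⟨m, hm⟩
      exact ⟨-m, by push_cast; linarith⟩
  ext y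
  constructor
  · rintro ⟨x, ⟨h1, h2, h3⟩, rfl⟩
    refine ⟨fun i hi => ?_, ?_, fun j => ?_⟩
    · rw [hcoord]
      rintro ⟨m, hm⟩
      exact (floor_eq_and_notInt_iff (m := 0).mp (by simpa using h1 i hi)).1
        ⟨m, by simpa using hm⟩
    · rwa [hskew, ← hneg]
    · rw [hcoord]
      exact h3 j
  · rintro ⟨h1, h2, h3⟩
    obtain ⟨z, rfl⟩ := surjective_torusQuot d y
    obtain ⟨x, hxz, hx⟩ : ∃ x, torusQuot d x = torusQuot d z ∧ ∀ i, 0 ≤ x i ∧ x i < 1 :=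
      ⟨fun i => Int.fract (z i), torusQuot_eq_iff.mpr fun i => ⟨-⌊z i⌋, by
        rw [Int.fract]; push_cast; ring⟩,
        fun i => ⟨Int.fract_nonneg _, Int.fract_lt_one _⟩⟩
    rw [← hxz] at h1 h2 h3 ⊢
    refine ⟨x, ⟨fun i hi => ⟨lt_of_le_of_ne (hx i).1 fun h => ?_, (hx i).2⟩, ?_, fun j => ?_⟩, rfl⟩
    · exact h1 i hi ((hcoord i 0 x).mpr ⟨0, by simp [← h]⟩)
    · rwa [hneg, ← hskew]
    · rw [← hcoord]
      exact h3 j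

/-- For `d ≥ 3`, `n > d`, `k ≥ 0`, and reals `c 1, …, c (n-d)` with pairwise distinct
fractional parts such that `k * c j + 1/2` is never an integer, the complement in `T^d`
of the union of the subtori `φ({x | x i = 0})` for `2 ≤ i ≤ d`,
`φ({x | x 2 = k * x 1 + 1/2})`, and `φ({x | x 1 = c j})` for `1 ≤ j ≤ n - d`
has exactly `2n - 2d + k` connected components. -/
theorem card_components_skew_arrangement
    (d n k : ℕ) (hd : 3 ≤ d) (hn : d < n)
    (c : Fin (n - d) → ℝ)
    (hc : ∀ i j, Int.fract (c i) = Int.fract (c j) → i = j)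
    (hkc : ∀ j, ¬∃ m : ℤ, (k : ℝ) * c j + 1 / 2 = (m : ℝ)) :
    Nat.card (ConnectedComponents ↥(
      ((⋃ i : Fin (d - 1),
          torusQuot d '' {x | x ⟨i.1 + 1, by have := i.isLt; omega⟩ = 0}) ∪
       (torusQuot d '' {x | x ⟨1, by omega⟩ = (k : ℝ) * x ⟨0, by omega⟩ + 1 / 2}) ∪
       (⋃ j : Fin (n - d), torusQuot d '' {x | x ⟨0, by omega⟩ = c j}))ᶜ))
      = 2 * n - 2 * d + k := by
  have hpq : (⟨1, by omega⟩ : Fin d) ≠ ⟨0, by omega⟩ := by simp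
  have : Nonempty (Fin (n - d)) := ⟨⟨0, by omega⟩⟩
  have key := card_connectedComponents_image_liftedComplement k c hc hkc hpq
  rw [torusQuot_image_liftedComplement k c hpq, Fintype.card_fin] at key
  rw [show 2 * n - 2 * d + k = k + 2 * (n - d) by omega, ← key]
  refine congrArg (fun s : Set (FlatTorus d) => Nat.card (ConnectedComponents s)) ?_
  ext y
  simp only [Set.mem_compl_iff, Set.mem_union, Set.mem_iUnion, not_or, not_exists, Set.mem_ofPred_eq,
    and_assoc]
  refine and_congr_left fun _ => ⟨fun h i hi => ?_, fun h i => h _ (by simp)⟩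
  obtain ⟨i, hid⟩ := i
  obtain ⟨i, rfl⟩ := Nat.exists_eq_succ_of_ne_zero (n := i) (by simpa using hi)
  exact h ⟨i, by omega⟩
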